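/- Let n ≥ 1. There is a constant C = C(n) such that for all p ∈ [1,∞], all ν ≥ 0, all t ≥ 0, all k ∈ ℤⁿ, and all Schwartz functions f on ℝⁿ whose Fourier transform is supported in {ξ : |ξ_j - k_j| ≤ 1 for all j}, one has ‖G_ν(t) f‖_{L^p(ℝⁿ)} ≤ C (1 + t^{n/2}) ‖f‖_{L^p(ℝⁿ)}. -/

import Mathlib

open MeasureTheory

noncomputable section

/-- `e r = exp (i r)`. -/
def e (r : ℝ) : ℂ := Complex.exp (Complex.I * (r : ℂ))

/-- The Fourier transform: `𝓕 f (ξ) = ∫ e^{-ix·ξ} f x dx`. -/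
def FT {n : ℕ} (f : (Fin n → ℝ) → ℂ) (ξ : Fin n → ℝ) : ℂ :=
  ∫ x : Fin n → ℝ, e (-(∑ j, x j * ξ j)) * f x

/-- The Ginzburg–Landau semigroup `G_ν(t) f = 𝓕⁻¹(e^{-it|ξ|² - νt|ξ|²} 𝓕f)`. -/
def Gnu {n : ℕ} (ν : ℝ) (f : (Fin n → ℝ) → ℂ) (t : ℝ) (x : Fin n → ℝ) : ℂ :=
  ((2 * Real.pi) ^ n)⁻¹ •
    ∫ ξ : Fin n → ℝ,
      e ((∑ j, x j * ξ j) - t * (∑ j, ξ j ^ 2)) *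
        (Real.exp (-(ν * t * (∑ j, ξ j ^ 2))) : ℂ) * FT f ξ

open FourierTransform

/-- Jensen's inequality for a weighted integral. -/
lemma lintegral_mul_rpow_le {α : Type*} [MeasurableSpace α] {μ : Measure α} {k φ : α → ENNReal}
    (hk : Measurable k) (hφ : Measurable φ) {p : ℝ} (hp : 1 ≤ p) :
    (∫⁻ y, k y * φ y ∂μ) ^ p ≤ (∫⁻ y, k y ∂μ) ^ (p - 1) * ∫⁻ y, k y * φ y ^ p ∂μ := by
  have hp0 : 0 < p := by linarith
  have h := eLpNorm'_le_eLpNorm'_mul_rpow_measure_univ (μ := μ.withDensity k) (f := φ)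
    one_pos hp hφ.aestronglyMeasurable
  simp only [eLpNorm'_eq_lintegral_enorm, enorm_eq_self, ENNReal.rpow_one, div_one] at h
  rw [withDensity_apply _ MeasurableSet.univ, Measure.restrict_univ,
    lintegral_withDensity_eq_lintegral_mul _ hk hφ,
    lintegral_withDensity_eq_lintegral_mul _ hk (hφ.pow_const p)] at h
  calc (∫⁻ y, k y * φ y ∂μ) ^ p
      ≤ ((∫⁻ y, k y * φ y ^ p ∂μ) ^ (1 / p) * (∫⁻ y, k y ∂μ) ^ (1 - 1 / p)) ^ p :=
        ENNReal.rpow_le_rpow h hp0.le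
    _ = _ := by
        rw [ENNReal.mul_rpow_of_nonneg _ _ hp0.le, ← ENNReal.rpow_mul, ← ENNReal.rpow_mul,
          mul_comm]
        congr 2
        · field_simp
        · rw [one_div, inv_mul_cancel₀ hp0.ne', ENNReal.rpow_one]

/-- Young's convolution inequality `L¹ * L^p ⊆ L^p`. -/
lemma eLpNorm_integral_sub_mul_le {G : Type*} [AddCommGroup G] [MeasurableSpace G]
    [MeasurableAdd₂ G] [MeasurableNeg G] {μ : Measure G} [SFinite μ] [μ.IsAddLeftInvariant]
    [μ.IsNegInvariant] {K f : G → ℂ} (hK : Measurable K) (hf : Measurable f)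
    {p : ENNReal} (hp : 1 ≤ p) :
    eLpNorm (fun x => ∫ y, K (x - y) * f y ∂μ) p μ ≤ (∫⁻ x, ‖K x‖ₑ ∂μ) * eLpNorm f p μ := by
  have hpt (x : G) : ‖∫ y, K (x - y) * f y ∂μ‖ₑ ≤ ∫⁻ y, ‖K (x - y)‖ₑ * ‖f y‖ₑ ∂μ := by
    simpa only [enorm_mul] using enorm_integral_le_lintegral_enorm (μ := μ) fun y => K (x - y) * f y
  have hKx (x : G) : ∫⁻ y, ‖K (x - y)‖ₑ ∂μ = ∫⁻ y, ‖K y‖ₑ ∂μ :=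
    lintegral_sub_left_eq_self (fun y => ‖K y‖ₑ) x
  rcases eq_or_ne p ⊤ with rfl | hptop
  · simp only [eLpNorm_exponent_top]
    refine eLpNormEssSup_le_of_ae_enorm_bound (.of_forall fun x => (hpt x).trans ?_)
    calc ∫⁻ y, ‖K (x - y)‖ₑ * ‖f y‖ₑ ∂μ
        ≤ ∫⁻ y, ‖K (x - y)‖ₑ * eLpNormEssSup f μ ∂μ := by
          refine lintegral_mono_ae ?_
          filter_upwards [ae_le_eLpNormEssSup (f := f) (μ := μ)] with y hy
          gcongr
      _ = _ := by
          rw [lintegral_mul_const _ (by fun_prop), hKx]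
  · have hp0 : p ≠ 0 := (zero_lt_one.trans_le hp).ne'
    have hp1 : 1 ≤ p.toReal := by
      simpa using ENNReal.toReal_mono hptop hp
    have hpos : 0 < p.toReal := by linarith
    rw [eLpNorm_eq_lintegral_rpow_enorm_toReal hp0 hptop,
      eLpNorm_eq_lintegral_rpow_enorm_toReal hp0 hptop]
    set q := p.toReal
    set A := ∫⁻ x, ‖K x‖ₑ ∂μ
    have hm : ∫⁻ x, ‖∫ y, K (x - y) * f y ∂μ‖ₑ ^ q ∂μ ≤ A ^ q * ∫⁻ y, ‖f y‖ₑ ^ q ∂μ := by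
      calc ∫⁻ x, ‖∫ y, K (x - y) * f y ∂μ‖ₑ ^ q ∂μ
          ≤ ∫⁻ x, A ^ (q - 1) * ∫⁻ y, ‖K (x - y)‖ₑ * ‖f y‖ₑ ^ q ∂μ ∂μ := by
            refine lintegral_mono fun x => (ENNReal.rpow_le_rpow (hpt x) hpos.le).trans ?_
            have := lintegral_mul_rpow_le (μ := μ) (k := fun y => ‖K (x - y)‖ₑ)
              (φ := fun y => ‖f y‖ₑ) (by fun_prop) (by fun_prop) hp1
            rwa [hKx] at this
        _ = A ^ (q - 1) * ∫⁻ y, ∫⁻ x, ‖K (x - y)‖ₑ * ‖f y‖ₑ ^ q ∂μ ∂μ := by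
            rw [lintegral_const_mul, lintegral_lintegral_swap]
            · fun_prop
            · refine Measurable.lintegral_prod_right ?_
              fun_prop
        _ = A ^ (q - 1) * (A * ∫⁻ y, ‖f y‖ₑ ^ q ∂μ) := by
            congr 1
            rw [← lintegral_const_mul _ (by fun_prop)]
            refine lintegral_congr fun y => ?_
            rw [lintegral_mul_const _ (by fun_prop),
              lintegral_sub_right_eq_self (fun y => ‖K y‖ₑ) y]
        _ = _ := by
            rw [← mul_assoc]
            congr 1
            nth_rw 2 [← ENNReal.rpow_one A]
            rw [← ENNReal.rpow_add_of_nonneg _ _ (by linarith) zero_le_one, sub_add_cancel]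
    calc _ ≤ (A ^ q * ∫⁻ y, ‖f y‖ₑ ^ q ∂μ) ^ (1 / q) := by gcongr
      _ = _ := by
        rw [ENNReal.mul_rpow_of_nonneg _ _ (by positivity), ← ENNReal.rpow_mul,
          mul_one_div_cancel hpos.ne', ENNReal.rpow_one]

/-- A quantitative form of Bernstein's inequality `‖𝓕 g‖₁ ≲ (‖g‖₂ ‖∂g‖₂)^{1/2}`. -/
lemma integral_norm_fourier_le (g : SchwartzMap ℝ ℂ) {a r : ℝ} (ha : 0 < a) (hr : 0 < r) :
    ∫ x, ‖𝓕 (g : ℝ → ℂ) x‖ ≤ r + (a * (∫ x, ‖g x‖ ^ 2) + (∫ x, ‖deriv g x‖ ^ 2) / a) / r := by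
  have hsq (h : SchwartzMap ℝ ℂ) : Integrable fun x => ‖h x‖ ^ 2 :=
    (memLp_two_iff_integrable_sq_norm h.continuous.aestronglyMeasurable).1 (h.memLp 2)
  have hder (x : ℝ) : ‖𝓕 (SchwartzMap.derivCLM ℂ ℂ g) x‖ ^ 2 =
      (2 * Real.pi * x) ^ 2 * ‖𝓕 g x‖ ^ 2 := by
    have h1 : ((SchwartzMap.derivCLM ℂ ℂ g : SchwartzMap ℝ ℂ) : ℝ → ℂ) = deriv g := by
      ext; simp
    rw [SchwartzMap.fourier_coe, SchwartzMap.fourier_coe, h1, Real.fourier_deriv g.integrable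
      g.differentiable (h1 ▸ (SchwartzMap.derivCLM ℂ ℂ g).integrable)]
    simp [mul_pow]
  have hg2 : ∫ x, ‖𝓕 g x‖ ^ 2 = ∫ x, ‖g x‖ ^ 2 := g.integral_norm_sq_fourier
  have hd2 : ∫ x, ‖𝓕 (SchwartzMap.derivCLM ℂ ℂ g) x‖ ^ 2 = ∫ x, ‖deriv g x‖ ^ 2 := by
    rw [SchwartzMap.integral_norm_sq_fourier]
    simp
  set c := 2 * Real.pi / a with hc
  have hcpos : 0 < c := by positivity
  have hint : Integrable fun x : ℝ => (1 + (c * x) ^ 2)⁻¹ :=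
    integrable_inv_one_add_sq.comp_mul_left' hcpos.ne'
  have hval : ∫ x : ℝ, (1 + (c * x) ^ 2)⁻¹ = a / 2 := by
    rw [Measure.integral_comp_mul_left (fun x : ℝ => (1 + x ^ 2)⁻¹),
      integral_univ_inv_one_add_sq, abs_of_pos (by positivity), hc, smul_eq_mul]
    field_simp
  rw [← SchwartzMap.fourier_coe]
  calc ∫ x, ‖𝓕 g x‖ ≤ ∫ x, (r / a * (1 + (c * x) ^ 2)⁻¹ + (a / r * ‖𝓕 g x‖ ^ 2
        + 1 / (a * r) * ‖𝓕 (SchwartzMap.derivCLM ℂ ℂ g) x‖ ^ 2)) := by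
        refine integral_mono (𝓕 g).integrable.norm ((hint.const_mul _).add
          (((hsq (𝓕 g)).const_mul _).add ((hsq _).const_mul _))) fun x => ?_
        beta_reduce
        rw [hder x]
        have hw : 0 < 1 + (c * x) ^ 2 := by positivity
        have e1 : a / r * ‖𝓕 g x‖ ^ 2 + 1 / (a * r) * ((2 * Real.pi * x) ^ 2 * ‖𝓕 g x‖ ^ 2)
            = a / r * (1 + (c * x) ^ 2) * ‖𝓕 g x‖ ^ 2 := by
          rw [hc]; field_simp
        rw [e1]
        generalize 1 + (c * x) ^ 2 = w at hw
        generalize ‖𝓕 g x‖ = u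
        have e2 : r / a * w⁻¹ + a / r * w * u ^ 2 - u =
          (r / a * w⁻¹) * ((a / r * w * u - 1 / 2) ^ 2 + 3 / 4) := by
          field_simp; ring
        have : 0 ≤ (r / a * w⁻¹) * ((a / r * w * u - 1 / 2) ^ 2 + 3 / 4) := by positivity
        linarith
    _ = r / a * (a / 2) + (a / r * ∫ x, ‖g x‖ ^ 2) + 1 / (a * r) * ∫ x, ‖deriv g x‖ ^ 2 := by
        rw [integral_add (hint.const_mul _) (by
            exact ((hsq (𝓕 g)).const_mul _).add ((hsq _).const_mul _)),
          integral_add ((hsq (𝓕 g)).const_mul _) ((hsq _).const_mul _), integral_const_mul,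
          integral_const_mul, integral_const_mul, hval, hg2, hd2]
        ring
    _ ≤ _ := by
        have : r / a * (a / 2) = r - r / 2 := by field_simp; ring
        rw [this]
        have : (a * (∫ x, ‖g x‖ ^ 2) + (∫ x, ‖deriv g x‖ ^ 2) / a) / r =
          (a / r * ∫ x, ‖g x‖ ^ 2) + 1 / (a * r) * ∫ x, ‖deriv g x‖ ^ 2 := by field_simp
        linarith

/-- A smooth cutoff on `ℝ`, equal to `1` on `[-1, 1]` and supported in `[-2, 2]`. -/
def cutoff : ContDiffBump (0 : ℝ) := ⟨1, 2, one_pos, one_lt_two⟩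

/-- The frequency-localized Ginzburg–Landau symbol, recentred at the frequency `κ` and with its
linear phase removed; here `s = νt`. -/
def recentredSymbol (t s κ ξ : ℝ) : ℂ :=
  Complex.exp (-(Complex.I * t * ξ ^ 2) - s * (ξ + κ) ^ 2) * (cutoff ξ : ℂ)

lemma contDiff_recentredSymbol (t s κ : ℝ) {m : ℕ∞} : ContDiff ℝ m (recentredSymbol t s κ) := by
  have h1 : ContDiff ℝ m fun ξ : ℝ => (ξ : ℂ) := Complex.ofRealCLM.contDiff
  have h2 : ContDiff ℝ m fun ξ : ℝ => (cutoff ξ : ℂ) :=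
    Complex.ofRealCLM.contDiff.comp cutoff.contDiff
  unfold recentredSymbol
  fun_prop

lemma hasCompactSupport_recentredSymbol (t s κ : ℝ) :
    HasCompactSupport (recentredSymbol t s κ) :=
  (cutoff.hasCompactSupport.comp_left Complex.ofReal_zero).mul_left

lemma norm_exp_phase (t s κ ξ : ℝ) :
    ‖Complex.exp (-(Complex.I * t * ξ ^ 2) - s * (ξ + κ) ^ 2)‖ = Real.exp (-s * (ξ + κ) ^ 2) := by
  rw [Complex.norm_exp]
  congr 1
  simp [← Complex.ofReal_pow, ← Complex.ofReal_add]

lemma cutoff_eq_zero {ξ : ℝ} (h : 2 ≤ |ξ|) : cutoff ξ = 0 :=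
  cutoff.zero_of_le_dist (by simpa [cutoff] using h)

lemma cutoff_le_indicator (ξ : ℝ) : cutoff ξ ≤ (Set.Icc (-2 : ℝ) 2).indicator 1 ξ := by
  by_cases h : ξ ∈ Set.Icc (-2 : ℝ) 2
  · simpa [h] using cutoff.le_one
  · rw [Set.indicator_of_notMem h, cutoff_eq_zero]
    rw [Set.mem_Icc, ← abs_le] at h
    exact (not_le.1 h).le

lemma exists_norm_deriv_cutoff_le : ∃ D : ℝ, 0 ≤ D ∧ ∀ ξ : ℝ,
    |deriv cutoff ξ| ≤ D * (Set.Icc (-2 : ℝ) 2).indicator 1 ξ := by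
  have hc : Continuous (deriv cutoff) :=
    (cutoff.contDiff (n := 1)).continuous_deriv le_rfl
  obtain ⟨D, hD⟩ := hc.bounded_above_of_compact_support cutoff.hasCompactSupport.deriv
  refine ⟨D, (norm_nonneg _).trans (hD 0), fun ξ => ?_⟩
  by_cases h : ξ ∈ Set.Icc (-2 : ℝ) 2
  · simpa [h] using hD ξ
  · rw [Set.indicator_of_notMem h, mul_zero, abs_nonpos_iff]
    refine Function.notMem_support.1 fun hξ => h ?_
    have := support_deriv_subset hξ
    rw [cutoff.tsupport_eq, Real.closedBall_eq_Icc] at this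
    simpa [cutoff] using this

lemma hasDerivAt_recentredSymbol (t s κ ξ : ℝ) :
    HasDerivAt (recentredSymbol t s κ)
      (Complex.exp (-(Complex.I * t * ξ ^ 2) - s * (ξ + κ) ^ 2) *
        ((-(2 * Complex.I * t * ξ) - 2 * s * (ξ + κ)) * (cutoff ξ : ℂ)
          + (deriv cutoff ξ : ℝ))) ξ := by
  have h1 : HasDerivAt (fun ξ : ℝ => (ξ : ℂ)) 1 ξ := Complex.ofRealCLM.hasDerivAt
  have h2 : HasDerivAt (fun ξ : ℝ => (cutoff ξ : ℂ)) ((deriv cutoff ξ : ℝ) : ℂ) ξ :=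
    (((cutoff.contDiff (n := 1)).differentiable one_ne_zero) ξ).hasDerivAt.ofReal_comp
  have h3 := ((((h1.pow 2).const_mul (Complex.I * t)).neg.sub
    (((h1.add_const (κ : ℂ)).pow 2).const_mul (s : ℂ))).cexp).mul h2
  convert! h3 using 1
  simp
  ring

lemma integral_exp_neg_mul_add_sq (b κ : ℝ) :
    ∫ ξ : ℝ, Real.exp (-b * (ξ + κ) ^ 2) = √(Real.pi / b) := by
  rw [integral_add_right_eq_self (fun ξ : ℝ => Real.exp (-b * ξ ^ 2)), integral_gaussian]

lemma integral_indicator_Icc : ∫ ξ : ℝ, (Set.Icc (-2 : ℝ) 2).indicator (1 : ℝ → ℝ) ξ = 4 := by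
  rw [integral_indicator_one measurableSet_Icc]
  norm_num [measureReal_def]

lemma integrable_indicator_Icc :
    Integrable ((Set.Icc (-2 : ℝ) 2).indicator (1 : ℝ → ℝ)) :=
  (integrable_indicator_iff measurableSet_Icc).2 (by simp [Pi.one_def])

lemma norm_recentredSymbol (t s κ ξ : ℝ) :
    ‖recentredSymbol t s κ ξ‖ = Real.exp (-s * (ξ + κ) ^ 2) * cutoff ξ := by
  rw [recentredSymbol, norm_mul, norm_exp_phase, Complex.norm_real,
    Real.norm_of_nonneg cutoff.nonneg]

lemma integral_norm_sq_recentredSymbol_le_four (t : ℝ) {s : ℝ} (hs : 0 ≤ s) (κ : ℝ) :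
    ∫ ξ, ‖recentredSymbol t s κ ξ‖ ^ 2 ≤ 4 := by
  rw [← integral_indicator_Icc]
  refine integral_mono_of_nonneg (.of_forall fun ξ => by positivity) integrable_indicator_Icc
    (.of_forall fun ξ => ?_)
  beta_reduce
  rw [norm_recentredSymbol]
  have h1 : Real.exp (-s * (ξ + κ) ^ 2) ≤ 1 := Real.exp_le_one_iff.2 (by
    have := mul_nonneg hs (sq_nonneg (ξ + κ)); linarith)
  have h2 : Real.exp (-s * (ξ + κ) ^ 2) * cutoff ξ ≤ cutoff ξ :=
    mul_le_of_le_one_left cutoff.nonneg h1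
  have h0 : 0 ≤ Real.exp (-s * (ξ + κ) ^ 2) * cutoff ξ :=
    mul_nonneg (Real.exp_pos _).le cutoff.nonneg
  exact (pow_le_of_le_one h0 (h2.trans cutoff.le_one) two_ne_zero).trans
    (h2.trans (cutoff_le_indicator ξ))

lemma sqrt_mul_integral_norm_sq_recentredSymbol_le (t : ℝ) {s : ℝ} (hs : 0 ≤ s) (κ : ℝ) :
    √s * ∫ ξ, ‖recentredSymbol t s κ ξ‖ ^ 2 ≤ 2 := by
  rcases hs.eq_or_lt with rfl | hs
  · simp
  have h : ∫ ξ, ‖recentredSymbol t s κ ξ‖ ^ 2 ≤ √(Real.pi / s) := by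
    rw [← integral_exp_neg_mul_add_sq s κ]
    refine integral_mono_of_nonneg (.of_forall fun ξ => by positivity)
      ((integrable_exp_neg_mul_sq hs).comp_add_right κ) (.of_forall fun ξ => ?_)
    beta_reduce
    rw [norm_recentredSymbol]
    have h1 : Real.exp (-s * (ξ + κ) ^ 2) ≤ 1 := Real.exp_le_one_iff.2 (by
      have := mul_nonneg hs.le (sq_nonneg (ξ + κ)); linarith)
    have h2 : Real.exp (-s * (ξ + κ) ^ 2) * cutoff ξ ≤ Real.exp (-s * (ξ + κ) ^ 2) :=
      mul_le_of_le_one_right (Real.exp_pos _).le cutoff.le_one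
    have h0 : 0 ≤ Real.exp (-s * (ξ + κ) ^ 2) * cutoff ξ :=
      mul_nonneg (Real.exp_pos _).le cutoff.nonneg
    exact (pow_le_of_le_one h0 (h2.trans h1) two_ne_zero).trans h2
  calc √s * ∫ ξ, ‖recentredSymbol t s κ ξ‖ ^ 2 ≤ √s * √(Real.pi / s) := by gcongr
    _ = √Real.pi := by rw [← Real.sqrt_mul hs.le, mul_div_cancel₀ _ hs.ne']
    _ ≤ 2 := Real.sqrt_le_iff.2 ⟨by norm_num, by linarith [Real.pi_le_four]⟩

lemma norm_deriv_recentredSymbol_sq_le {t s κ ξ D : ℝ} (ht : 0 ≤ t) (hs : 0 ≤ s)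
    (hD : |deriv cutoff ξ| ≤ D * (Set.Icc (-2 : ℝ) 2).indicator 1 ξ) :
    ‖deriv (recentredSymbol t s κ) ξ‖ ^ 2 ≤
      2 * (4 * t + D) ^ 2 * (Set.Icc (-2 : ℝ) 2).indicator 1 ξ
        + 8 * s * Real.exp (-s * (ξ + κ) ^ 2) := by
  rw [(hasDerivAt_recentredSymbol t s κ ξ).deriv, norm_mul, norm_exp_phase]
  set E := Real.exp (-s * (ξ + κ) ^ 2) with hE
  set χ : ℝ := (Set.Icc (-2 : ℝ) 2).indicator 1 ξ with hχ
  have hE0 : 0 < E := Real.exp_pos _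
  have hE1 : E ≤ 1 := Real.exp_le_one_iff.2 (by
    have := mul_nonneg hs (sq_nonneg (ξ + κ)); linarith)
  have hc : cutoff ξ ≤ χ := cutoff_le_indicator ξ
  have hc0 : 0 ≤ cutoff ξ := cutoff.nonneg
  have hc1 : cutoff ξ ≤ 1 := cutoff.le_one
  have hχ2 : χ ^ 2 = χ := by
    rw [hχ]; by_cases h : ξ ∈ Set.Icc (-2 : ℝ) 2 <;> simp [h]
  have hξ : |ξ| * cutoff ξ ≤ 2 * χ := by
    rcases le_total 2 |ξ| with h | h
    · rw [cutoff_eq_zero h, mul_zero]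
      linarith
    · gcongr
  have h1 : ‖(-(2 * Complex.I * t * ξ) - 2 * s * (ξ + κ)) * (cutoff ξ : ℂ)
      + (deriv cutoff ξ : ℝ)‖ ≤ (4 * t + D) * χ + 2 * s * |ξ + κ| := by
    calc _ ≤ ‖2 * Complex.I * t * ξ * (cutoff ξ : ℂ)‖ + ‖2 * s * (ξ + κ) * (cutoff ξ : ℂ)‖
          + ‖((deriv cutoff ξ : ℝ) : ℂ)‖ := by
          refine (norm_add_le _ _).trans (add_le_add_left ?_ _)
          rw [sub_mul, neg_mul]
          refine (norm_sub_le _ _).trans (by rw [norm_neg])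
      _ = 2 * t * (|ξ| * cutoff ξ) + 2 * s * |ξ + κ| * cutoff ξ + |deriv cutoff ξ| := by
          simp only [norm_mul, Complex.norm_ofNat, Complex.norm_I, Complex.norm_real,
            ← Complex.ofReal_add, Real.norm_eq_abs, abs_of_nonneg ht, abs_of_nonneg hs,
            abs_of_nonneg hc0]
          ring
      _ ≤ 2 * t * (2 * χ) + 2 * s * |ξ + κ| * 1 + D * χ := by gcongr
      _ = _ := by ring
  have h2 : s * (ξ + κ) ^ 2 * E ≤ 1 := by
    have h3 : s * (ξ + κ) ^ 2 ≤ Real.exp (s * (ξ + κ) ^ 2) :=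
      (le_add_of_nonneg_right zero_le_one).trans (Real.add_one_le_exp _)
    calc _ ≤ Real.exp (s * (ξ + κ) ^ 2) * E := by gcongr
      _ = 1 := by rw [hE, ← Real.exp_add]; simp
  calc _ ≤ (E * ((4 * t + D) * χ + 2 * s * |ξ + κ|)) ^ 2 := by gcongr
    _ = E ^ 2 * ((4 * t + D) * χ + 2 * s * |ξ + κ|) ^ 2 := by ring
    _ ≤ E ^ 2 * (2 * (((4 * t + D) * χ) ^ 2 + (2 * s * |ξ + κ|) ^ 2)) := by
        gcongr
        exact add_sq_le
    _ = E ^ 2 * (2 * (4 * t + D) ^ 2 * χ ^ 2) + 8 * s * E * (s * (ξ + κ) ^ 2 * E) := by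
        rw [mul_pow (2 * s), sq_abs]; ring
    _ ≤ 1 * (2 * (4 * t + D) ^ 2 * χ ^ 2) + 8 * s * E * 1 := by
        gcongr
        exact pow_le_one₀ hE0.le hE1
    _ = _ := by rw [hχ2]; ring

lemma integral_norm_sq_deriv_recentredSymbol_le {D : ℝ}
    (hD : ∀ ξ : ℝ, |deriv cutoff ξ| ≤ D * (Set.Icc (-2 : ℝ) 2).indicator 1 ξ)
    {t s : ℝ} (ht : 0 ≤ t) (hs : 0 ≤ s) (κ : ℝ) :
    ∫ ξ, ‖deriv (recentredSymbol t s κ) ξ‖ ^ 2 ≤ 8 * (4 * t + D) ^ 2 + 16 * √s := by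
  have hint : Integrable fun ξ : ℝ => 8 * s * Real.exp (-s * (ξ + κ) ^ 2) := by
    rcases hs.eq_or_lt with rfl | hs
    · simp
    · exact ((integrable_exp_neg_mul_sq hs).comp_add_right κ).const_mul _
  calc _ ≤ ∫ ξ, (2 * (4 * t + D) ^ 2 * (Set.Icc (-2 : ℝ) 2).indicator 1 ξ
        + 8 * s * Real.exp (-s * (ξ + κ) ^ 2)) :=
        integral_mono_of_nonneg (.of_forall fun ξ => by positivity)
          ((integrable_indicator_Icc.const_mul _).add hint)
          (.of_forall fun ξ => norm_deriv_recentredSymbol_sq_le ht hs (hD ξ))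
    _ = 8 * (4 * t + D) ^ 2 + 8 * (s * √(Real.pi / s)) := by
        rw [integral_add (integrable_indicator_Icc.const_mul _) hint, integral_const_mul,
          integral_const_mul, integral_indicator_Icc, integral_exp_neg_mul_add_sq]
        ring
    _ ≤ _ := by
        have : s * √(Real.pi / s) ≤ 2 * √s := by
          rw [Real.sqrt_div Real.pi_pos.le, ← mul_div_assoc, mul_comm, mul_div_assoc, Real.div_sqrt]
          gcongr
          exact Real.sqrt_le_iff.2 ⟨by norm_num, by linarith [Real.pi_le_four]⟩
        linarith

lemma exists_integral_norm_fourier_recentredSymbol_le :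
    ∃ C : ℝ, 0 < C ∧ ∀ t s κ : ℝ, 0 ≤ t → 0 ≤ s →
      ∫ x, ‖𝓕 (recentredSymbol t s κ) x‖ ≤ C * √(1 + t) := by
  obtain ⟨D, hD0, hD⟩ := exists_norm_deriv_cutoff_le
  refine ⟨23 + 8 * (4 + D) ^ 2, by positivity, fun t s κ ht hs => ?_⟩
  have hr : 0 < √(1 + t) := Real.sqrt_pos.2 (by linarith)
  have hs' : 0 ≤ √s := Real.sqrt_nonneg s
  have ha : 0 < 1 + t + √s := by linarith
  have h : ∫ x, ‖𝓕 (recentredSymbol t s κ) x‖ ≤ √(1 + t) +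
      ((1 + t + √s) * (∫ x, ‖recentredSymbol t s κ x‖ ^ 2) +
        (∫ x, ‖deriv (recentredSymbol t s κ) x‖ ^ 2) / (1 + t + √s)) / √(1 + t) :=
    integral_norm_fourier_le ((hasCompactSupport_recentredSymbol t s κ).toSchwartzMap
      (contDiff_recentredSymbol t s κ)) ha hr
  have hA : (1 + t + √s) * (∫ x, ‖recentredSymbol t s κ x‖ ^ 2) ≤ 6 * (1 + t) := by
    have h4 := mul_le_mul_of_nonneg_left (integral_norm_sq_recentredSymbol_le_four t hs κ)
      (by linarith : 0 ≤ 1 + t)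
    have h2 := sqrt_mul_integral_norm_sq_recentredSymbol_le t hs κ
    rw [add_mul]
    linarith
  have hB : (∫ x, ‖deriv (recentredSymbol t s κ) x‖ ^ 2) / (1 + t + √s)
      ≤ (16 + 8 * (4 + D) ^ 2) * (1 + t) := by
    rw [div_le_iff₀ ha]
    refine (integral_norm_sq_deriv_recentredSymbol_le hD ht hs κ).trans ?_
    have h1 : (4 * t + D) ^ 2 ≤ ((4 + D) * (1 + t)) ^ 2 := by
      gcongr
      nlinarith
    have h2 : 0 ≤ (4 + D) ^ 2 * ((1 + t) * √s) := by positivity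
    nlinarith [mul_nonneg ht hs', mul_nonneg ht ht]
  calc _ ≤ √(1 + t) + (6 * (1 + t) + (16 + 8 * (4 + D) ^ 2) * (1 + t)) / √(1 + t) := by
        refine h.trans ?_
        gcongr
    _ = _ := by
        rw [← add_mul, mul_div_assoc, Real.div_sqrt]
        ring

lemma e_add (a b : ℝ) : e (a + b) = e a * e b := by
  simp [e, mul_add, Complex.exp_add]

lemma e_sum {ι : Type*} (s : Finset ι) (a : ι → ℝ) : e (∑ j ∈ s, a j) = ∏ j ∈ s, e (a j) := by
  simp [e, Finset.mul_sum, Complex.exp_sum]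

lemma norm_e (a : ℝ) : ‖e a‖ = 1 := by
  rw [e, mul_comm, Complex.norm_exp_ofReal_mul_I]

@[fun_prop]
lemma continuous_e : Continuous e := by
  unfold e
  fun_prop

/-- The one-dimensional Ginzburg–Landau symbol localized near the frequency `κ`, with `s = νt`. -/
def localizedSymbol (t s κ ξ : ℝ) : ℂ :=
  e (-(t * ξ ^ 2)) * (Real.exp (-(s * ξ ^ 2)) : ℂ) * (cutoff (ξ - κ) : ℂ)

/-- The convolution kernel of the multiplier `localizedSymbol t s κ`. -/
def localizedKernel (t s κ x : ℝ) : ℂ :=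
  (2 * Real.pi : ℝ)⁻¹ * ∫ ξ, e (x * ξ) * localizedSymbol t s κ ξ

lemma localizedSymbol_eq (t s κ ξ : ℝ) :
    localizedSymbol t s κ (ξ + κ) =
      e (-(t * κ ^ 2) + -(2 * t * κ * ξ)) * recentredSymbol t s κ ξ := by
  simp only [localizedSymbol, recentredSymbol, e, Complex.ofReal_exp, add_sub_cancel_right,
    ← mul_assoc, ← Complex.exp_add]
  congr 2
  push_cast
  ring

lemma integrable_localizedSymbol (t s κ : ℝ) : Integrable (localizedSymbol t s κ) := by
  have h : Integrable fun ξ => localizedSymbol t s κ (ξ + κ) := by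
    simp_rw [localizedSymbol_eq]
    refine Integrable.bdd_mul (c := 1) ?_ (by fun_prop) (.of_forall fun ξ => (norm_e _).le)
    exact (contDiff_recentredSymbol t s κ (m := 0)).continuous.integrable_of_hasCompactSupport
      (hasCompactSupport_recentredSymbol t s κ)
  simpa using h.comp_sub_right κ

lemma localizedKernel_eq (t s κ x : ℝ) :
    localizedKernel t s κ x = (2 * Real.pi : ℝ)⁻¹ * (e (x * κ - t * κ ^ 2) *
      𝓕 (recentredSymbol t s κ) (-(2 * Real.pi)⁻¹ * (x - 2 * t * κ))) := by
  rw [localizedKernel,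
    ← integral_add_right_eq_self (fun ξ => e (x * ξ) * localizedSymbol t s κ ξ) κ,
    Real.fourier_real_eq_integral_exp_smul, ← integral_const_mul (e (x * κ - t * κ ^ 2))]
  congr 1
  refine integral_congr_ae (.of_forall fun ξ => ?_)
  beta_reduce
  rw [localizedSymbol_eq, smul_eq_mul, ← mul_assoc, ← mul_assoc, ← e_add]
  congr 1
  simp only [e, ← Complex.exp_add]
  congr 1
  push_cast
  field_simp
  ring

lemma continuous_fourier_recentredSymbol (t s κ : ℝ) :
    Continuous (𝓕 (recentredSymbol t s κ)) :=
  (𝓕 ((hasCompactSupport_recentredSymbol t s κ).toSchwartzMap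
    (contDiff_recentredSymbol t s κ))).continuous

lemma continuous_localizedKernel (t s κ : ℝ) : Continuous (localizedKernel t s κ) := by
  have := continuous_fourier_recentredSymbol t s κ
  rw [funext (localizedKernel_eq t s κ)]
  fun_prop

lemma norm_localizedKernel (t s κ x : ℝ) : ‖localizedKernel t s κ x‖ =
    (2 * Real.pi)⁻¹ *
      ‖𝓕 (recentredSymbol t s κ) (-(2 * Real.pi)⁻¹ * (x - 2 * t * κ))‖ := by
  rw [localizedKernel_eq, norm_mul, norm_mul, norm_e, one_mul, Complex.norm_real,
    Real.norm_of_nonneg (by positivity)]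

lemma integrable_localizedKernel (t s κ : ℝ) : Integrable (localizedKernel t s κ) := by
  rw [← integrable_norm_iff (continuous_localizedKernel t s κ).aestronglyMeasurable]
  simp_rw [norm_localizedKernel]
  have h : Integrable fun x => ‖𝓕 (recentredSymbol t s κ) x‖ :=
    (𝓕 ((hasCompactSupport_recentredSymbol t s κ).toSchwartzMap
      (contDiff_recentredSymbol t s κ))).integrable.norm
  exact ((h.comp_mul_left' (neg_ne_zero.2 (by positivity : (2 * Real.pi)⁻¹ ≠ 0))).comp_sub_right
    (2 * t * κ)).const_mul _

lemma integral_norm_localizedKernel (t s κ : ℝ) :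
    ∫ x, ‖localizedKernel t s κ x‖ = ∫ x, ‖𝓕 (recentredSymbol t s κ) x‖ := by
  simp_rw [norm_localizedKernel]
  rw [integral_const_mul, integral_sub_right_eq_self
    (fun x => ‖𝓕 (recentredSymbol t s κ) (-(2 * Real.pi)⁻¹ * x)‖) (2 * t * κ),
    Measure.integral_comp_mul_left (fun x => ‖𝓕 (recentredSymbol t s κ) x‖), smul_eq_mul,
    ← mul_assoc, inv_neg, abs_neg, inv_inv, abs_of_pos (by positivity),
    inv_mul_cancel₀ (by positivity), one_mul]

/-- On frequencies in the cube around `k`, the Ginzburg–Landau symbol is the product of the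
one-dimensional localized symbols. -/
lemma symbol_mul_FT_eq {n : ℕ} {k : Fin n → ℤ} {f : (Fin n → ℝ) → ℂ}
    (hf : ∀ ξ : Fin n → ℝ, (∃ j, 1 < |ξ j - (k j : ℝ)|) → FT f ξ = 0)
    (ν t : ℝ) (x ξ : Fin n → ℝ) :
    e ((∑ j, x j * ξ j) - t * (∑ j, ξ j ^ 2)) *
        (Real.exp (-(ν * t * (∑ j, ξ j ^ 2))) : ℂ) * FT f ξ =
      e (∑ j, x j * ξ j) * (∏ j, localizedSymbol t (ν * t) (k j) (ξ j)) * FT f ξ := by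
  by_cases h : ∃ j, 1 < |ξ j - (k j : ℝ)|
  · simp [hf ξ h]
  push Not at h
  have hc (j : Fin n) : cutoff (ξ j - k j) = 1 :=
    cutoff.one_of_mem_closedBall (by simpa [cutoff] using h j)
  simp only [localizedSymbol, hc, Complex.ofReal_one, mul_one, Finset.prod_mul_distrib]
  rw [sub_eq_add_neg, e_add, ← e_sum, ← Complex.ofReal_prod, ← Real.exp_sum,
    Finset.sum_neg_distrib, Finset.sum_neg_distrib, ← Finset.mul_sum, ← Finset.mul_sum]
  ring

/-- On functions with frequencies in the cube around `k`, the semigroup is the convolution with a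
product of one-dimensional kernels. -/
lemma Gnu_eq_convolution {n : ℕ} {k : Fin n → ℤ} {f : (Fin n → ℝ) → ℂ} (hfi : Integrable f)
    (hf : ∀ ξ : Fin n → ℝ, (∃ j, 1 < |ξ j - (k j : ℝ)|) → FT f ξ = 0)
    (ν t : ℝ) (x : Fin n → ℝ) :
    Gnu ν f t x = ∫ y, (∏ j, localizedKernel t (ν * t) (k j) ((x - y) j)) * f y := by
  set M : (Fin n → ℝ) → ℂ := fun ξ => ∏ j, localizedSymbol t (ν * t) (k j) (ξ j) with hM
  have hMi : Integrable M := Integrable.fintype_prod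
    (fun j => integrable_localizedSymbol t (ν * t) (k j))
  have hswap : Integrable (Function.uncurry fun ξ y : Fin n → ℝ =>
      e (∑ j, (x - y) j * ξ j) * (M ξ * f y)) (volume.prod volume) := by
    refine Integrable.bdd_mul (c := 1) (hMi.mul_prod hfi) ?_ (.of_forall fun z => (norm_e _).le)
    have : Continuous fun z : (Fin n → ℝ) × (Fin n → ℝ) => e (∑ j, (x - z.2) j * z.1 j) := by
      simp only [Pi.sub_apply]
      fun_prop
    exact this.aestronglyMeasurable
  have hinner (ξ : Fin n → ℝ) : e (∑ j, x j * ξ j) * M ξ * FT f ξ =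
      ∫ y, e (∑ j, (x - y) j * ξ j) * (M ξ * f y) := by
    rw [FT, ← integral_const_mul]
    congr 1
    ext y
    simp only [Pi.sub_apply, sub_mul, Finset.sum_sub_distrib]
    rw [sub_eq_add_neg, e_add]
    ring
  have hker (y : Fin n → ℝ) : ∫ ξ, e (∑ j, (x - y) j * ξ j) * (M ξ * f y) =
      (∏ j, ∫ ξ, e ((x - y) j * ξ) * localizedSymbol t (ν * t) (k j) ξ) * f y := by
    rw [← integral_fintype_prod_volume_eq_prod, ← integral_mul_const]
    congr 1
    ext ξ
    rw [e_sum, Finset.prod_mul_distrib, hM]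
    ring
  have hGnu : Gnu ν f t x =
      ((2 * Real.pi) ^ n)⁻¹ • ∫ ξ, e (∑ j, x j * ξ j) * M ξ * FT f ξ := by
    simp_rw [Gnu, symbol_mul_FT_eq hf, hM]
  simp_rw [hGnu, hinner]
  rw [integral_integral_swap hswap, ← integral_smul]
  simp_rw [hker]
  congr 1
  ext y
  simp only [localizedKernel, Finset.prod_mul_distrib, Finset.prod_const, Finset.card_univ,
    Fintype.card_fin, Complex.real_smul]
  push_cast
  rw [inv_pow]
  ring

lemma lintegral_enorm_prod_localizedKernel {n : ℕ} (t s : ℝ) (κ : Fin n → ℝ) :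
    ∫⁻ x : Fin n → ℝ, ‖∏ j, localizedKernel t s (κ j) (x j)‖ₑ =
      ENNReal.ofReal (∏ j, ∫ x, ‖localizedKernel t s (κ j) x‖) := by
  have h : Integrable fun x : Fin n → ℝ => ∏ j, localizedKernel t s (κ j) (x j) :=
    Integrable.fintype_prod fun j => integrable_localizedKernel t s (κ j)
  rw [← integral_fintype_prod_volume_eq_prod, ← ofReal_integral_norm_eq_lintegral_enorm h]
  simp only [norm_prod]

lemma mul_sqrt_one_add_pow_le (n : ℕ) {C t : ℝ} (hC : 0 ≤ C) (ht : 0 ≤ t) :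
    (C * √(1 + t)) ^ n ≤ (2 * C) ^ n * (1 + t ^ ((n : ℝ) / 2)) := by
  have h1 : √(1 + t) ≤ 1 + √t :=
    Real.sqrt_le_iff.2 ⟨by positivity, by nlinarith [Real.sq_sqrt ht, Real.sqrt_nonneg t]⟩
  have h2 : (1 + √t) ^ n ≤ 2 ^ n * (1 + √t ^ n) := by
    refine (add_pow_le zero_le_one (Real.sqrt_nonneg t) n).trans ?_
    rw [one_pow]
    gcongr
    · norm_num
    · omega
  rw [Real.rpow_div_two_eq_sqrt _ ht, Real.rpow_natCast, mul_pow, mul_pow]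
  calc C ^ n * √(1 + t) ^ n ≤ C ^ n * (1 + √t) ^ n := by gcongr
    _ ≤ C ^ n * (2 ^ n * (1 + √t ^ n)) := by gcongr
    _ = _ := by ring

/-- the frequency-localized Ginzburg–Landau semigroup is bounded on
every `L^p`, `1 ≤ p ≤ ∞`, uniformly in `ν ≥ 0` and `k ∈ ℤⁿ`:
`‖G_ν(t) f‖_{L^p} ≤ C (1 + t^{n/2}) ‖f‖_{L^p}` for Schwartz `f` whose Fourier
transform is supported in the unit cube around `k`. -/
theorem stmt_8 (n : ℕ) (hn : 1 ≤ n) :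
    ∃ C : ℝ, 0 < C ∧
      ∀ p : ENNReal, 1 ≤ p →
      ∀ (ν : ℝ), 0 ≤ ν → ∀ (t : ℝ), 0 ≤ t →
      ∀ (k : Fin n → ℤ),
      ∀ f : SchwartzMap (Fin n → ℝ) ℂ,
        (∀ ξ : Fin n → ℝ, (∃ j, 1 < |ξ j - (k j : ℝ)|) → FT (⇑f) ξ = 0) →
        eLpNorm (fun x => Gnu ν (⇑f) t x) p volume
          ≤ ENNReal.ofReal (C * (1 + t ^ ((n : ℝ) / 2))) * eLpNorm (⇑f) p volume := by
  obtain ⟨C, hC, hbound⟩ := exists_integral_norm_fourier_recentredSymbol_le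
  refine ⟨(2 * C) ^ n, by positivity, fun p hp ν hν t ht k f hf => ?_⟩
  have hs : 0 ≤ ν * t := mul_nonneg hν ht
  simp_rw [Gnu_eq_convolution f.integrable hf]
  have hK : Measurable fun x : Fin n → ℝ => ∏ j, localizedKernel t (ν * t) (k j) (x j) :=
    (continuous_finsetProd _ fun j _ =>
      (continuous_localizedKernel t (ν * t) (k j)).comp (continuous_apply j)).measurable
  refine (eLpNorm_integral_sub_mul_le hK f.continuous.measurable hp).trans ?_
  gcongr
  rw [lintegral_enorm_prod_localizedKernel t (ν * t) fun j => (k j : ℝ)]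
  refine ENNReal.ofReal_le_ofReal (le_trans ?_ (mul_sqrt_one_add_pow_le n hC.le ht))
  calc ∏ j, ∫ x, ‖localizedKernel t (ν * t) (k j) x‖ ≤ ∏ _j : Fin n, C * √(1 + t) :=
        Finset.prod_le_prod (fun j _ => integral_nonneg fun x => norm_nonneg _) fun j _ => by
          rw [integral_norm_localizedKernel]
          exact hbound t (ν * t) (k j) ht hs
    _ = _ := by simp
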